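/- arXiv:1806.03206 — 3 statements merged into one kernel-verified Lean document; each statement's English description precedes it below -/
import Mathlib

section
/- Let X be a compact Polish space, let P = (X, d, x̄) be any presentation of X, and let F ⊆ X be a nonempty countable closed subset. Then φ_P(F) < ω·|F|_CB (ordinal multiplication). -/
open Set Filter Topology

/-- A presentation `(X, d, x̄)` of a Polish space `X`: a complete metric `d`
compatible with the topology of `X`, together with a dense sequence `x̄`. -/
structure Presentation (X : Type) [TopologicalSpace X] where
  dist : X → X → ℝ
  seq : ℕ → X
  dist_self : ∀ x, dist x x = 0
  eq_of_dist_eq_zero : ∀ x y, dist x y = 0 → x = y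
  dist_comm : ∀ x y, dist x y = dist y x
  dist_triangle : ∀ x y z, dist x z ≤ dist x y + dist y z
  /-- `d` is compatible with the topology of `X`. -/
  isOpen_iff : ∀ s : Set X, IsOpen s ↔ ∀ x ∈ s, ∃ ε > 0, ∀ y, dist y x < ε → y ∈ s
  /-- `d` is complete. -/
  complete : ∀ u : ℕ → X, (∀ ε > 0, ∃ N, ∀ m ≥ N, ∀ n ≥ N, dist (u m) (u n) < ε) →
      ∃ x, ∀ ε > 0, ∃ N, ∀ n ≥ N, dist (u n) x < ε
  /-- the sequence `x̄` is dense. -/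
  dense : ∀ x, ∀ ε > 0, ∃ i, dist x (seq i) < ε

namespace Presentation

variable {X : Type} [TopologicalSpace X] (P : Presentation X)

/-- The open ball `B_P(n)`. -/
def ball (n : ℕ × ℕ) : Set X := {x | P.dist x (P.seq n.1) < (1/2 : ℝ) ^ (n.2 + 1)}

/-- The closed ball `B̄_P(n)`. -/
def cball (n : ℕ × ℕ) : Set X := {x | P.dist x (P.seq n.1) ≤ (1/2 : ℝ) ^ (n.2 + 1)}

/-- The relation `n ≺_P m`. -/
def prec (n m : ℕ × ℕ) : Prop := n.2 < m.2 ∧ P.cball m ⊆ P.ball n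

/-- The relation `n ⋏_P m`. -/
def apart (n m : ℕ × ℕ) : Prop := P.cball n ∩ P.cball m = ∅

/-- The code `A_F^P` of a closed set `F ⊆ X`. -/
def code (F : Set X) : Set (ℕ × ℕ) := {n | (P.ball n ∩ F).Nonempty}

/-- The derivative `D_P` on subsets of `ω × ω`. -/
def deriv (A : Set (ℕ × ℕ)) : Set (ℕ × ℕ) :=
  {n ∈ A | ∃ u ∈ A, ∃ v ∈ A, P.prec n u ∧ P.prec n v ∧ P.apart u v}

/-- The transfinite iterates `D_P^α(A)`. -/
noncomputable def derivIter (A : Set (ℕ × ℕ)) (α : Ordinal.{0}) : Set (ℕ × ℕ) :=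
  Ordinal.limitRecOn α A (fun _ ih => P.deriv ih)
    (fun o _ ih => ⋂ (β : {β : Ordinal.{0} // β < o}), ih β.1 β.2)

/-- The rank `|A|_P`: the least ordinal `α` with `D_P^α(A) = D_P^{α+1}(A)`. -/
noncomputable def rankA (A : Set (ℕ × ℕ)) : Ordinal.{0} :=
  sInf {α | P.derivIter A (α + 1) = P.derivIter A α}

/-- The rank `φ_P(F) = |A_F^P|_P` of a (countable closed) subset `F ⊆ X`. -/
noncomputable def phi (F : Set X) : Ordinal.{0} := P.rankA (P.code F)

/-- `A ⊆ ω × ω` is `P`-closed. -/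
def PClosed (A : Set (ℕ × ℕ)) : Prop := ∀ n ∈ A, ∀ m, P.prec m n → m ∈ A

/-- `A ⊆ ω × ω` is `P`-pruned. -/
def PPruned (A : Set (ℕ × ℕ)) : Prop := ∀ n ∈ A, ∃ m ∈ A, P.prec n m

/-- `A ⊆ ω × ω` is `P`-perfect. -/
def PPerfect (A : Set (ℕ × ℕ)) : Prop :=
  ∀ n ∈ A, ∃ u ∈ A, ∃ v ∈ A, P.prec n u ∧ P.prec n v ∧ P.apart u v

/-- The set `[A]_P` of `P`-compatible sequences lying in `A`. -/
def body (A : Set (ℕ × ℕ)) : Set (ℕ → ℕ × ℕ) :=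
  {f | (∀ i, P.prec (f i) (f (i + 1))) ∧ ∀ i, f i ∈ A}

/-- The set `F_A^P = π_P([A]_P)`: the points obtained as the unique point of
`⋂_i B_P(n_i)` for a `P`-compatible sequence `(n_i)` in `A`. -/
def limitSet (A : Set (ℕ × ℕ)) : Set X :=
  {x | ∃ f ∈ P.body A, ∀ i, x ∈ P.ball (f i)}

end Presentation

section CB

variable {X : Type} [TopologicalSpace X]

/-- The Cantor–Bendixson derivative: the set of limit points of `F` in `F`. -/
def cbDeriv (F : Set X) : Set X := {x ∈ F | AccPt x (𝓟 F)}

/-- The iterated Cantor–Bendixson derivatives `F^α`. -/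
noncomputable def cbIter (F : Set X) (α : Ordinal.{0}) : Set X :=
  Ordinal.limitRecOn α F (fun _ ih => cbDeriv ih)
    (fun o _ ih => ⋂ (β : {β : Ordinal.{0} // β < o}), ih β.1 β.2)

/-- The Cantor–Bendixson rank `|F|_CB`. -/
noncomputable def cbRank (F : Set X) : Ordinal.{0} :=
  sInf {α | cbIter F (α + 1) = cbIter F α}

/-- The `K_σ`-derivative of a subset `A ⊆ X`: the points of `A` having no open
neighborhood in the subspace `A` whose closure in `A` is compact. -/
def kDeriv (A : Set X) : Set X :=
  {x ∈ A | ∀ U : Set X, IsOpen U → x ∈ U → ¬ IsCompact (A ∩ closure (U ∩ A))}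

/-- The iterated `K_σ`-derivatives `X_α` of the space `X`. -/
noncomputable def kIter (X : Type) [TopologicalSpace X] (α : Ordinal.{0}) : Set X :=
  Ordinal.limitRecOn α Set.univ (fun _ ih => kDeriv ih)
    (fun o _ ih => ⋂ (β : {β : Ordinal.{0} // β < o}), ih β.1 β.2)

/-- The `K_σ`-rank `|X|_{K_σ}`. -/
noncomputable def kRank (X : Type) [TopologicalSpace X] : Ordinal.{0} :=
  sInf {α | kIter X (α + 1) = kIter X α}

end CB

open Order

section TransfiniteIteration

variable {α : Type}

/-- The transfinite iterates of `f` on `A`, taking intersections at limits. -/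
noncomputable def transIter (f : Set α → Set α) (A : Set α) (o : Ordinal.{0}) : Set α :=
  Ordinal.limitRecOn o A (fun _ ih => f ih)
    (fun o _ ih => ⋂ (β : {β : Ordinal.{0} // β < o}), ih β.1 β.2)

theorem transIter_zero (f : Set α → Set α) (A : Set α) : transIter f A 0 = A :=
  Ordinal.limitRecOn_zero ..

theorem transIter_add_one (f : Set α → Set α) (A : Set α) (o : Ordinal.{0}) :
    transIter f A (o + 1) = f (transIter f A o) :=
  Ordinal.limitRecOn_add_one ..

theorem transIter_limit (f : Set α → Set α) (A : Set α) {o : Ordinal.{0}} (h : IsSuccLimit o) :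
    transIter f A o = ⋂ β : {β : Ordinal.{0} // β < o}, transIter f A β.1 :=
  Ordinal.limitRecOn_limit _ _ _ _ h

theorem transIter_antitone {f : Set α → Set α} (hf : ∀ S, f S ⊆ S) (A : Set α) :
    Antitone (transIter f A) := by
  intro a b hab
  induction b using Ordinal.limitRecOn with
  | zero =>
    obtain rfl : a = 0 := le_antisymm hab bot_le
    exact le_rfl
  | add_one b ih =>
    rcases hab.eq_or_lt with rfl | h
    · exact le_rfl
    · rw [transIter_add_one]
      exact (hf _).trans (ih (Order.lt_add_one_iff.1 h))
  | limit b hb _ =>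
    rcases hab.eq_or_lt with rfl | h
    · exact le_rfl
    · rw [transIter_limit f A hb]
      exact iInter_subset (fun β : {β : Ordinal.{0} // β < b} => transIter f A β.1) ⟨a, h⟩

theorem exists_transIter_add_one_eq {f : Set α → Set α} (hf : ∀ S, f S ⊆ S) (A : Set α) :
    ∃ o, transIter f A (o + 1) = transIter f A o := by
  by_contra! h
  refine not_injective_of_ordinal (transIter f A) (StrictAnti.injective fun a b hab => ?_)
  have hanti := transIter_antitone hf A
  exact (hanti (Order.add_one_le_of_lt hab)).trans_lt
    ((hanti (Order.le_succ a)).lt_of_ne (h a))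

end TransfiniteIteration

section CantorBendixson

variable {X : Type} [TopologicalSpace X]

theorem cbDeriv_subset (S : Set X) : cbDeriv S ⊆ S := fun _ h => h.1

theorem cbIter_antitone (F : Set X) : Antitone (cbIter F) :=
  transIter_antitone cbDeriv_subset F

theorem cbIter_zero (F : Set X) : cbIter F 0 = F :=
  transIter_zero _ _

theorem cbIter_add_one (F : Set X) (o : Ordinal.{0}) :
    cbIter F (o + 1) = cbDeriv (cbIter F o) :=
  transIter_add_one _ _ _

theorem cbIter_limit (F : Set X) {o : Ordinal.{0}} (h : IsSuccLimit o) :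
    cbIter F o = ⋂ β : {β : Ordinal.{0} // β < o}, cbIter F β.1 :=
  transIter_limit _ _ h

theorem IsClosed.cbDeriv [T1Space X] {F : Set X} (hF : IsClosed F) : IsClosed (cbDeriv F) :=
  hF.inter (isClosed_derivedSet F)

theorem IsClosed.cbIter [T1Space X] {F : Set X} (hF : IsClosed F) (o : Ordinal.{0}) :
    IsClosed (cbIter F o) := by
  induction o using Ordinal.limitRecOn with
  | zero => rwa [cbIter_zero]
  | add_one o ih => rw [cbIter_add_one]; exact ih.cbDeriv
  | limit o ho ih =>
    rw [cbIter_limit F ho]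
    exact isClosed_iInter fun β => ih β.1 β.2

theorem inter_cbDeriv_nonempty_of_infinite [CompactSpace X] {C K : Set X} (hC : IsClosed C)
    (hK : IsClosed K) (h : (C ∩ K).Infinite) : (C ∩ cbDeriv K).Nonempty := by
  obtain ⟨x, hx, hacc⟩ := h.exists_accPt_of_subset_isCompact (hC.inter hK).isCompact subset_rfl
  exact ⟨x, hx.1, hx.2, hacc.mono (principal_mono.2 inter_subset_right)⟩

theorem inter_cbIter_nonempty_of_isSuccLimit [T1Space X] [CompactSpace X] {C F : Set X}
    (hC : IsClosed C) (hF : IsClosed F) {o : Ordinal.{0}} (ho : IsSuccLimit o)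
    (h : ∀ β < o, (C ∩ cbIter F β).Nonempty) : (C ∩ cbIter F o).Nonempty := by
  rw [cbIter_limit F ho]
  have : Nonempty {β : Ordinal.{0} // β < o} := ⟨⟨0, ho.bot_lt⟩⟩
  rw [inter_iInter]
  have hcl : ∀ β : {β : Ordinal.{0} // β < o}, IsClosed (C ∩ cbIter F β.1) :=
    fun β => hC.inter (hF.cbIter β.1)
  refine IsCompact.nonempty_iInter_of_directed_nonempty_isCompact_isClosed _
    (Antitone.directed_ge fun a b hab => ?_) (fun β => h β.1 β.2) (fun β => (hcl β).isCompact) hcl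
  exact inter_subset_inter_right _ (cbIter_antitone F hab)

theorem eq_empty_of_cbDeriv_eq_self [PolishSpace X] {K : Set X} (hK : IsClosed K)
    (hcnt : K.Countable) (h : cbDeriv K = K) : K = ∅ := by
  let _ := TopologicalSpace.upgradeIsCompletelyMetrizable X
  by_contra hne
  obtain ⟨f, hfK, -, hinj⟩ := Perfect.exists_nat_bool_injection
    (⟨hK, fun x hx => (h.symm ▸ hx : x ∈ cbDeriv K).2⟩ : Perfect K) (nonempty_iff_ne_empty.2 hne)
  have hcount : Countable (ℕ → Bool) := by
    have := (hcnt.mono hfK).preimage_of_injOn (f := f) hinj.injOn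
    rwa [preimage_range, countable_univ_iff] at this
  have hle := Cardinal.mk_le_aleph0_iff.2 hcount
  rw [← Cardinal.power_def, Cardinal.mk_bool, Cardinal.mk_nat, Cardinal.two_power_aleph0] at hle
  exact Cardinal.aleph0_lt_continuum.not_ge hle

/-- The Cantor–Bendixson rank of a nonempty countable closed subset of a compact Polish space is
a successor, and the last nonempty derivative is finite. -/
theorem exists_cbRank_eq_add_one [PolishSpace X] [CompactSpace X] {F : Set X} (hF : IsClosed F)
    (hcnt : F.Countable) (hne : F.Nonempty) :
    ∃ β, cbRank F = β + 1 ∧ (cbIter F β).Finite := by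
  have hstab : cbIter F (cbRank F + 1) = cbIter F (cbRank F) :=
    csInf_mem (s := {α | cbIter F (α + 1) = cbIter F α})
      (exists_transIter_add_one_eq cbDeriv_subset F)
  have hempty : cbIter F (cbRank F) = ∅ := by
    refine eq_empty_of_cbDeriv_eq_self (hF.cbIter _) (hcnt.mono ?_) ?_
    · exact (cbIter_antitone F bot_le).trans (cbIter_zero F).le
    · rwa [cbIter_add_one] at hstab
  have hnonempty : ∀ β < cbRank F, (cbIter F β).Nonempty := by
    intro β hβ
    by_contra h
    rw [not_nonempty_iff_eq_empty] at h
    refine notMem_of_lt_csInf' hβ (?_ : cbIter F (β + 1) = cbIter F β)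
    rw [h]
    exact subset_empty_iff.1 (h ▸ cbIter_antitone F (Order.le_succ β))
  rcases Ordinal.zero_or_succ_or_isSuccLimit (cbRank F) with h | ⟨β, h⟩ | h
  · rw [h, cbIter_zero] at hempty
    exact absurd hempty hne.ne_empty
  · refine ⟨β, h.symm, ?_⟩
    by_contra hinf
    have := inter_cbDeriv_nonempty_of_infinite isClosed_univ (hF.cbIter β)
      (by rwa [univ_inter] : (univ ∩ cbIter F β).Infinite)
    rw [univ_inter, ← cbIter_add_one] at this
    exact this.ne_empty (by rw [← hempty, ← h]; rfl)
  · have := inter_cbIter_nonempty_of_isSuccLimit isClosed_univ hF h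
      (by simpa only [univ_inter] using hnonempty)
    rw [univ_inter] at this
    exact absurd hempty this.ne_empty

end CantorBendixson

namespace Presentation

variable {X : Type} [TopologicalSpace X] (P : Presentation X)

theorem isClosed_cball (n : ℕ × ℕ) : IsClosed (P.cball n) := by
  rw [← isOpen_compl_iff, P.isOpen_iff]
  intro x hx
  simp only [cball, mem_compl_iff, mem_ofPred_eq, not_le] at hx ⊢
  refine ⟨_, sub_pos.2 hx, fun y hy => ?_⟩
  have := P.dist_triangle x y (P.seq n.1)
  rw [P.dist_comm x y] at this
  linarith

theorem ball_subset_cball (n : ℕ × ℕ) : P.ball n ⊆ P.cball n :=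
  fun _ hx => le_of_lt (show P.dist _ _ < _ from hx)

theorem prec.cball_subset {P : Presentation X} {n m : ℕ × ℕ} (h : P.prec n m) :
    P.cball m ⊆ P.cball n :=
  h.2.trans (P.ball_subset_cball n)

theorem deriv_subset (A : Set (ℕ × ℕ)) : P.deriv A ⊆ A := fun _ h => h.1

theorem derivIter_antitone (A : Set (ℕ × ℕ)) : Antitone (P.derivIter A) :=
  transIter_antitone P.deriv_subset A

theorem derivIter_zero (A : Set (ℕ × ℕ)) : P.derivIter A 0 = A :=
  transIter_zero _ _

theorem derivIter_add_one (A : Set (ℕ × ℕ)) (o : Ordinal.{0}) :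
    P.derivIter A (o + 1) = P.deriv (P.derivIter A o) :=
  transIter_add_one _ _ _

theorem rankA_le_of_derivIter_eq_empty {A : Set (ℕ × ℕ)} {o : Ordinal.{0}}
    (h : P.derivIter A o = ∅) : P.rankA A ≤ o := by
  refine csInf_le' (?_ : P.derivIter A (o + 1) = P.derivIter A o)
  rw [h]
  exact subset_empty_iff.1 (h ▸ P.derivIter_antitone A (Order.le_succ o))

/-- Each application of the derivative yields a further point of `K` in the closed balls. -/
theorem add_one_le_encard_cball_inter {A : Set (ℕ × ℕ)} {K : Set X} {o : Ordinal.{0}}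
    (h : ∀ n ∈ P.derivIter A o, (P.cball n ∩ K).Nonempty) (k : ℕ) :
    ∀ n ∈ P.derivIter A (o + k), (k + 1 : ℕ∞) ≤ (P.cball n ∩ K).encard := by
  induction k with
  | zero =>
    intro n hn
    rw [Nat.cast_zero, add_zero] at hn
    simpa [one_le_encard_iff_nonempty] using h n hn
  | succ k ih =>
    intro n hn
    rw [Nat.cast_succ, ← add_assoc, derivIter_add_one] at hn
    obtain ⟨-, u, hu, v, hv, hnu, hnv, huv⟩ := hn
    have hdisj : Disjoint (P.cball u ∩ K) (P.cball v ∩ K) :=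
      (disjoint_iff_inter_eq_empty.2 huv).mono inter_subset_left inter_subset_left
    have hv1 : (1 : ℕ∞) ≤ (P.cball v ∩ K).encard :=
      le_trans le_add_self (ih v hv)
    calc ((k + 1 : ℕ) + 1 : ℕ∞) ≤ (P.cball u ∩ K).encard + (P.cball v ∩ K).encard := by
          push_cast
          exact add_le_add (ih u hu) hv1
      _ = (P.cball u ∩ K ∪ P.cball v ∩ K).encard := (encard_union_eq hdisj).symm
      _ ≤ (P.cball n ∩ K).encard := encard_le_encard <| union_subset
          (inter_subset_inter_left _ hnu.cball_subset) (inter_subset_inter_left _ hnv.cball_subset)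

theorem cball_inter_cbIter_nonempty [T1Space X] [CompactSpace X] {F : Set X} (hF : IsClosed F)
    (o : Ordinal.{0}) :
    ∀ n ∈ P.derivIter (P.code F) (Ordinal.omega0 * o), (P.cball n ∩ cbIter F o).Nonempty := by
  induction o using Ordinal.limitRecOn with
  | zero =>
    intro n hn
    rw [mul_zero, derivIter_zero] at hn
    rw [cbIter_zero]
    exact Set.Nonempty.mono (inter_subset_inter_left _ (P.ball_subset_cball n)) hn
  | add_one o ih =>
    intro n hn
    rw [cbIter_add_one]
    refine inter_cbDeriv_nonempty_of_infinite (P.isClosed_cball n) (hF.cbIter o) ?_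
    rw [← encard_eq_top_iff, ENat.eq_top_iff_forall_ge]
    intro k
    refine le_trans le_self_add (P.add_one_le_encard_cball_inter ih k n ?_)
    refine P.derivIter_antitone _ ?_ hn
    rw [mul_add_one]
    gcongr
    exact (Ordinal.natCast_lt_omega0 k).le
  | limit o ho ih =>
    intro n hn
    refine inter_cbIter_nonempty_of_isSuccLimit (P.isClosed_cball n) hF ho fun β hβ =>
      ih β hβ n (P.derivIter_antitone _ ?_ hn)
    gcongr

end Presentation

/-- For a compact Polish space `X`, any presentation `P` and any nonempty
countable closed `F ⊆ X`, `φ_P(F) < ω·|F|_CB`. -/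
theorem stmt0 {X : Type} [TopologicalSpace X] [PolishSpace X] [CompactSpace X]
    (P : Presentation X) (F : Set X) (hF : IsClosed F) (hcnt : F.Countable)
    (hne : F.Nonempty) :
    P.phi F < Ordinal.omega0 * cbRank F := by
  obtain ⟨β, hβ, hfin⟩ := exists_cbRank_eq_add_one hF hcnt hne
  have hempty : P.derivIter (P.code F) (Ordinal.omega0 * β + (cbIter F β).ncard) = ∅ := by
    refine eq_empty_of_forall_notMem fun n hn => ?_
    have hle := (P.add_one_le_encard_cball_inter (P.cball_inter_cbIter_nonempty hF β) _ n hn).trans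
      (encard_le_encard inter_subset_right)
    rw [← hfin.cast_ncard_eq] at hle
    exact absurd (by exact_mod_cast hle) (Nat.not_succ_le_self (cbIter F β).ncard)
  refine (P.rankA_le_of_derivIter_eq_empty hempty).trans_lt ?_
  rw [hβ, mul_add_one]
  gcongr
  exact Ordinal.natCast_lt_omega0 _
end

section
/- Let P = (X, d, x̄) be any presentation of a Polish space X and let F ⊆ X be closed. Then for every ordinal α one has A_{F^α}^P ⊆ D_P^α(A_F^P), where F^α is the α-th iterated Cantor–Bendixson derivative of F. -/
open Set Filter Topology

namespace Presentation

variable {X : Type} [TopologicalSpace X] (P : Presentation X)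

theorem isOpen_ball (n : ℕ × ℕ) : IsOpen (P.ball n) := by
  rw [P.isOpen_iff]
  intro x hx
  refine ⟨(1/2 : ℝ) ^ (n.2 + 1) - P.dist x (P.seq n.1), sub_pos.2 hx, fun y hy => ?_⟩
  have := P.dist_triangle y x (P.seq n.1)
  change P.dist y (P.seq n.1) < _
  linarith

theorem dist_nonneg (x y : X) : 0 ≤ P.dist x y := by
  have h := P.dist_triangle x y x
  rw [P.dist_self, P.dist_comm y x] at h
  linarith

/-- Every point of a ball lies in an arbitrarily small ball strictly below it. -/
theorem exists_prec_small {n : ℕ × ℕ} {x : X} (hx : x ∈ P.ball n) {δ : ℝ} (hδ : 0 < δ) :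
    ∃ u, x ∈ P.ball u ∧ P.prec n u ∧ ∀ z ∈ P.cball u, P.dist z x < δ := by
  have hx' : P.dist x (P.seq n.1) < (1/2 : ℝ) ^ (n.2 + 1) := hx
  obtain ⟨m, hm⟩ := exists_pow_lt_of_lt_one
    (lt_min hδ (sub_pos.2 hx')) (by norm_num : (1/2 : ℝ) < 1)
  obtain ⟨hm₁, hm₂⟩ := lt_min_iff.1 hm
  set k := max m (n.2 + 1)
  have hkm : (1/2 : ℝ) ^ k ≤ (1/2 : ℝ) ^ m :=
    pow_le_pow_of_le_one (by norm_num) (by norm_num) (le_max_left _ _)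
  have hs : (1/2 : ℝ) ^ (k + 1) = (1/2 : ℝ) ^ k / 2 := by rw [pow_succ]; ring
  obtain ⟨i, hi⟩ := P.dense x ((1/2 : ℝ) ^ (k + 1)) (by positivity)
  have hsmall : ∀ z ∈ P.cball (i, k), P.dist z x < (1/2 : ℝ) ^ k := by
    intro z hz
    have hz' : P.dist z (P.seq i) ≤ (1/2 : ℝ) ^ (k + 1) := hz
    have := P.dist_triangle z (P.seq i) x
    rw [P.dist_comm (P.seq i) x] at this
    linarith
  refine ⟨(i, k), hi, ⟨Nat.lt_of_succ_le (le_max_right _ _), fun z hz => ?_⟩, fun z hz => ?_⟩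
  · have := hsmall z hz
    have := P.dist_triangle z x (P.seq n.1)
    change P.dist z (P.seq n.1) < _
    linarith
  · have := hsmall z hz
    linarith

theorem deriv_mono {A B : Set (ℕ × ℕ)} (h : A ⊆ B) : P.deriv A ⊆ P.deriv B := by
  rintro n ⟨hn, u, hu, v, hv, huv⟩
  exact ⟨h hn, u, h hu, v, h hv, huv⟩

theorem code_mono {F G : Set X} (h : F ⊆ G) : P.code F ⊆ P.code G :=
  fun _ hn => hn.mono (inter_subset_inter_right _ h)

theorem code_cbDeriv_subset (F : Set X) : P.code (cbDeriv F) ⊆ P.deriv (P.code F) := by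
  rintro n ⟨x, hxn, hxF, hacc⟩
  obtain ⟨y, ⟨hyn, hyF⟩, hne⟩ :=
    accPt_iff_nhds.1 hacc (P.ball n) ((P.isOpen_ball n).mem_nhds hxn)
  have hpos : 0 < P.dist x y :=
    lt_of_le_of_ne (P.dist_nonneg x y) fun h => hne (P.eq_of_dist_eq_zero x y h.symm).symm
  obtain ⟨u, hxu, hnu, hu⟩ := P.exists_prec_small hxn (half_pos hpos)
  obtain ⟨v, hyv, hnv, hv⟩ := P.exists_prec_small hyn (half_pos hpos)
  refine ⟨⟨x, hxn, hxF⟩, u, ⟨x, hxu, hxF⟩, v, ⟨y, hyv, hyF⟩, hnu, hnv, ?_⟩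
  refine eq_empty_iff_forall_notMem.2 fun z hz => ?_
  have h₁ := hu z hz.1
  have h₂ := hv z hz.2
  have h₃ := P.dist_triangle x z y
  rw [P.dist_comm x z] at h₃
  linarith

end Presentation

/-- For any presentation `P` of a Polish space `X`, any closed `F ⊆ X` and
any ordinal `α`, `A_{F^α}^P ⊆ D_P^α(A_F^P)`. -/
theorem stmt4 {X : Type} [TopologicalSpace X] [PolishSpace X] (P : Presentation X)
    (F : Set X) (hF : IsClosed F) (α : Ordinal.{0}) :
    P.code (cbIter F α) ⊆ P.derivIter (P.code F) α := by
  induction α using Ordinal.limitRecOn with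
  | zero => simp [cbIter, Presentation.derivIter]
  | add_one β ih =>
    have h₁ : cbIter F (β + 1) = cbDeriv (cbIter F β) := Ordinal.limitRecOn_add_one ..
    have h₂ : P.derivIter (P.code F) (β + 1) = P.deriv (P.derivIter (P.code F) β) :=
      Ordinal.limitRecOn_add_one ..
    rw [h₁, h₂]
    exact (P.code_cbDeriv_subset _).trans (P.deriv_mono ih)
  | limit o ho ih =>
    have h₁ : cbIter F o = ⋂ β : {β : Ordinal.{0} // β < o}, cbIter F β.1 :=
      Ordinal.limitRecOn_limit _ _ _ _ ho
    have h₂ : P.derivIter (P.code F) o =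
        ⋂ β : {β : Ordinal.{0} // β < o}, P.derivIter (P.code F) β.1 :=
      Ordinal.limitRecOn_limit _ _ _ _ ho
    rw [h₁, h₂]
    exact subset_iInter fun β => (P.code_mono (iInter_subset _ β)).trans (ih β.1 β.2)
end

section
/- Let X be a compact Polish space, P = (X, d, x̄) a presentation of X, and A ⊆ ω×ω a P-closed set. If there is a sequence (n_k)_{k∈ω} of elements of A such that n_k(1) → ∞ as k → ∞, then [A]_P ≠ ∅. -/
open Set Filter Topology

namespace Presentation

variable {X : Type} [TopologicalSpace X] (P : Presentation X)

theorem setOf_dist_lt_mem_nhds (x : X) {ε : ℝ} (hε : 0 < ε) : {y | P.dist y x < ε} ∈ 𝓝 x := by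
  refine IsOpen.mem_nhds ((P.isOpen_iff _).2 fun y hy => ?_) ?_
  · refine ⟨ε - P.dist y x, sub_pos.2 hy, fun z hz => ?_⟩
    have := P.dist_triangle z y x
    change P.dist z x < ε
    linarith
  · simpa [P.dist_self] using hε

/-- If the centers of `n` and `m` are close to a common point and `m` has the higher level, then
`n ≺_P m`. -/
theorem prec_of_dist_lt {x : X} {n m : ℕ × ℕ} (hlt : n.2 < m.2)
    (hn : P.dist x (P.seq n.1) < (1/2 : ℝ) ^ (n.2 + 1) / 4)
    (hm : P.dist (P.seq m.1) x < (1/2 : ℝ) ^ (n.2 + 1) / 4) : P.prec n m := by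
  refine ⟨hlt, fun y hy => ?_⟩
  have hy' : P.dist y (P.seq m.1) ≤ (1/2 : ℝ) ^ (m.2 + 1) := hy
  have hr : (1/2 : ℝ) ^ (m.2 + 1) ≤ (1/2 : ℝ) ^ (n.2 + 1 + 1) :=
    pow_le_pow_of_le_one (by norm_num) (by norm_num) (by omega)
  rw [pow_succ _ (n.2 + 1)] at hr
  have h₁ := P.dist_triangle y (P.seq m.1) (P.seq n.1)
  have h₂ := P.dist_triangle (P.seq m.1) x (P.seq n.1)
  change P.dist y (P.seq n.1) < (1/2 : ℝ) ^ (n.2 + 1)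
  linarith

end Presentation

/-- In a compact Polish space, if `A` is `P`-closed and contains elements
`n_k` with `n_k(1) → ∞`, then `[A]_P ≠ ∅`. -/
theorem stmt9 {X : Type} [TopologicalSpace X] [PolishSpace X] [CompactSpace X]
    (P : Presentation X) (A : Set (ℕ × ℕ)) (hA : P.PClosed A)
    (f : ℕ → ℕ × ℕ) (hf : ∀ k, f k ∈ A)
    (htend : Tendsto (fun k => (f k).2) atTop atTop) :
    (P.body A).Nonempty := by
  obtain ⟨x, hx⟩ := exists_clusterPt_of_compactSpace (map (fun k => P.seq (f k).1) atTop)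
  choose c hc using fun j : ℕ => P.dense x ((1/2 : ℝ) ^ (j + 1) / 4) (by positivity)
  refine ⟨fun j => (c j, j), fun j => ?_, fun j => ?_⟩
  · refine P.prec_of_dist_lt (Nat.lt_succ_self j) (hc j) ?_
    rw [P.dist_comm]
    refine (hc (j + 1)).trans_le (div_le_div_of_nonneg_right ?_ (by norm_num))
    exact pow_le_pow_of_le_one (by norm_num) (by norm_num) (Nat.le_succ (j + 1))
  · have hfreq : ∃ᶠ k in atTop, P.dist (P.seq (f k).1) x < (1/2 : ℝ) ^ (j + 1) / 4 :=
      MapClusterPt.frequently hx (P.setOf_dist_lt_mem_nhds x (by positivity))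
    obtain ⟨k, hk, hjk⟩ := (hfreq.and_eventually (htend.eventually_gt_atTop j)).exists
    exact hA (f k) (hf k) _ (P.prec_of_dist_lt hjk (hc j) hk)
end
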